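/- Let r ≥ 2, let F be the free group of rank r, let C ⊆ F be the set of cyclically reduced elements, and let P ⊆ C. Suppose there exist v ∈ F and a subset A ⊆ C that is exponentially generic in C such that no element w ∈ A whose cyclic reduction contains v as a subword lies in P. Then P is exponentially rare in C. -/

import Mathlib

namespace VG

variable {r : ℕ}

/-- Word length: the length of the unique freely reduced word representing `w`. -/
def len (w : FreeGroup (Fin r)) : ℕ := (FreeGroup.toWord w).length

/-- The number of elements of `A` of word length at most `n`. -/
noncomputable def ballCount (A : Set (FreeGroup (Fin r))) (n : ℕ) : ℕ :=
  {w | w ∈ A ∧ len w ≤ n}.ncard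

/-- The number of elements of `A` of word length exactly `n`. -/
noncomputable def sphereCount (A : Set (FreeGroup (Fin r))) (n : ℕ) : ℕ :=
  {w | w ∈ A ∧ len w = n}.ncard

/-- `A` is exponentially generic in `B`: there are `a > 0` and `b` such that, for all
sufficiently large `n`, the proportion of elements of `B` of length at most `n` lying
in `A` is at least `1 - exp (b - a n)`. -/
def ExpGeneric (A B : Set (FreeGroup (Fin r))) : Prop :=
  ∃ a : ℝ, 0 < a ∧ ∃ b : ℝ, ∃ N : ℕ, ∀ n : ℕ, N ≤ n →
    (1 : ℝ) - Real.exp (b - a * n) ≤ (ballCount A n : ℝ) / (ballCount B n)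

/-- `A` is exponentially rare in `B` if its complement in `B` is exponentially generic. -/
def ExpRare (A B : Set (FreeGroup (Fin r))) : Prop := ExpGeneric (B \ A) B

/-- `v` is a subword of `w`: the reduced word of `v` is a contiguous sublist of that of `w`. -/
def Subword (v w : FreeGroup (Fin r)) : Prop :=
  FreeGroup.toWord v <:+: FreeGroup.toWord w

/-- `w` is cyclically reduced: the first letter of its reduced word is not the inverse of
the last letter. -/
def CyclicallyReduced (w : FreeGroup (Fin r)) : Prop :=
  ∀ a ∈ (FreeGroup.toWord w).head?, ∀ b ∈ (FreeGroup.toWord w).getLast?,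
    a ≠ (b.1, !b.2)

/-- `c` is the cyclic reduction of `w`: it is cyclically reduced and conjugate to `w`. -/
def IsCyclicReduction (c w : FreeGroup (Fin r)) : Prop :=
  CyclicallyReduced c ∧ ∃ g : FreeGroup (Fin r), w = g * c * g⁻¹

/-- Middle third of a list: delete the first and last `⌈l/3⌉` entries. -/
def middleThird {α : Type*} (l : List α) : List α :=
  (l.drop ((l.length + 2) / 3)).take (l.length - 2 * ((l.length + 2) / 3))

/-- `v` is cyclically contained in `w` if the reduced word of `v` is a subword of some
positive power of the cyclic reduction of `w`. -/
def CyclicallyContains (w v : FreeGroup (Fin r)) : Prop :=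
  ∃ c : FreeGroup (Fin r), IsCyclicReduction c w ∧ ∃ k : ℕ, 1 ≤ k ∧ Subword v (c ^ k)

/-- `w` is full: every freely reduced word of length 3, or its inverse, is cyclically
contained in `w`. -/
def Full (w : FreeGroup (Fin r)) : Prop :=
  ∀ t : FreeGroup (Fin r), len t = 3 → CyclicallyContains w t ∨ CyclicallyContains w t⁻¹

/-- The group element corresponding to a single letter. -/
def letterElem (a : Fin r × Bool) : FreeGroup (Fin r) := FreeGroup.mk [a]

/-- The inverse of a letter. -/
def linv (a : Fin r × Bool) : Fin r × Bool := (a.1, !a.2)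

/-- `w` is a proper power: `w = u^k` for some `k ≥ 2`. -/
def ProperPower (w : FreeGroup (Fin r)) : Prop :=
  ∃ u : FreeGroup (Fin r), ∃ k : ℕ, 2 ≤ k ∧ w = u ^ k

/-- Minimal word length in the conjugacy class of `w`. -/
noncomputable def conjMinLen (w : FreeGroup (Fin r)) : ℕ :=
  sInf (len '' {u | IsConj u w})

/-- `w` is Whitehead minimal: for every automorphism `α` of the free group, the length of
`w` is at most the minimal length of an element conjugate to `α w`. -/
def WhiteheadMinimal (w : FreeGroup (Fin r)) : Prop :=
  ∀ α : FreeGroup (Fin r) ≃* FreeGroup (Fin r), len w ≤ conjMinLen (α w)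


section Helpers
open Finset FreeGroup
open scoped Classical

abbrev Lt (r : ℕ) := Fin r × Bool

/-- All reduced lists obtained from `u` by prepending `n` letters. -/
noncomputable def extn : ℕ → List (Lt r) → Finset (List (Lt r))
  | 0, u => {u}
  | n+1, u => (extn n u).biUnion
      (fun w => (univ.filter (fun x : Lt r => IsReduced (x :: w))).image (fun x => x :: w))

lemma mem_extn {u : List (Lt r)} (hu : IsReduced u) (n : ℕ) (w : List (Lt r)) :
    w ∈ extn n u ↔ IsReduced w ∧ ∃ p : List (Lt r), p.length = n ∧ w = p ++ u := by
  induction n generalizing w with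
  | zero =>
    simp only [extn, Finset.mem_singleton, List.length_eq_zero_iff]
    constructor
    · rintro rfl; exact ⟨hu, [], rfl, rfl⟩
    · rintro ⟨_, p, rfl, rfl⟩; rfl
  | succ n ih =>
    simp only [extn, Finset.mem_biUnion, Finset.mem_image, Finset.mem_filter, Finset.mem_univ,
      true_and]
    constructor
    · rintro ⟨w', hw', x, hx, rfl⟩
      obtain ⟨_, p, hp, rfl⟩ := (ih w').1 hw'
      exact ⟨hx, x :: p, by simp [hp], rfl⟩
    · rintro ⟨hw, p, hp, rfl⟩
      cases p with
      | nil => simp at hp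
      | cons x p =>
        refine ⟨p ++ u, (ih _).2 ⟨hw.infix (List.infix_cons (List.infix_refl _)), p, by simpa using hp, rfl⟩, x, hw, rfl⟩

lemma isReduced_cons_cons_iff (x b : Lt r) (t : List (Lt r)) :
    IsReduced (x :: b :: t) ↔ x ≠ (b.1, !b.2) ∧ IsReduced (b :: t) := by
  rw [FreeGroup.isReduced_cons_cons]
  refine and_congr_left fun _ => ?_
  obtain ⟨x1, x2⟩ := x
  obtain ⟨b1, b2⟩ := b
  cases x2 <;> cases b2 <;> simp

lemma card_letters {w : List (Lt r)} (hw : IsReduced w) (h0 : w ≠ []) :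
    (univ.filter (fun x : Lt r => IsReduced (x :: w))).card = 2 * r - 1 := by
  cases w with
  | nil => exact absurd rfl h0
  | cons b t =>
    have : univ.filter (fun x : Lt r => IsReduced (x :: b :: t)) = univ.erase (b.1, !b.2) := by
      ext x
      simp [isReduced_cons_cons_iff, hw, -FreeGroup.isReduced_cons_cons]
    rw [this, Finset.card_erase_of_mem (Finset.mem_univ _)]
    simp [mul_comm]

lemma card_extn {u : List (Lt r)} (hu : IsReduced u) (h0 : u ≠ []) (n : ℕ) :
    (extn n u).card = (2 * r - 1) ^ n := by
  induction n with
  | zero => simp [extn]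
  | succ n ih =>
    rw [extn, Finset.card_biUnion]
    · rw [Finset.sum_congr rfl (g := fun _ => 2 * r - 1), Finset.sum_const, ih, pow_succ, smul_eq_mul]
      intro w hw
      obtain ⟨hr, p, hp, rfl⟩ := (mem_extn hu n w).1 hw
      rw [Finset.card_image_of_injective _ (fun a b h => by simpa using h), card_letters hr (by simp [h0])]
    · intro a _ b _ hab
      simp only [Function.onFun]
      rw [Finset.disjoint_left]
      intro l h1 h2
      simp only [Finset.mem_image] at h1 h2
      obtain ⟨x, _, rfl⟩ := h1
      obtain ⟨y, _, h⟩ := h2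
      apply hab
      simp at h
      exact h.2.symm

lemma exists_letter (hr : 2 ≤ r) (a b : Lt r) : ∃ y : Lt r, y ≠ a ∧ y ≠ b := by
  have : ({a, b} : Finset (Lt r)).card < (univ : Finset (Lt r)).card := by
    have h1 : ({a, b} : Finset (Lt r)).card ≤ 2 := Finset.card_le_two
    have h2 : (univ : Finset (Lt r)).card = r * 2 := by simp
    omega
  obtain ⟨y, _, hy⟩ := Finset.exists_mem_notMem_of_card_lt_card this
  exact ⟨y, by simpa using hy⟩

lemma rel_iff (a b : Lt r) : (a.1 = b.1 → a.2 = b.2) ↔ b ≠ (a.1, !a.2) := by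
  obtain ⟨x1, x2⟩ := a
  obtain ⟨b1, b2⟩ := b
  cases x2 <;> cases b2 <;> simp [eq_comm]

lemma exists_glue (hr : 2 ≤ r) {v u : List (Lt r)} (hv : IsReduced v) (hu : IsReduced u)
    (h0 : u ≠ []) : ∃ y : Lt r, IsReduced (v ++ y :: u) := by
  cases u with
  | nil => exact absurd rfl h0
  | cons b t =>
    rcases List.eq_nil_or_concat v with rfl | ⟨v', z, rfl⟩
    · obtain ⟨y, hy, _⟩ := exists_letter hr (b.1, !b.2) (b.1, !b.2)
      exact ⟨y, by simpa using (isReduced_cons_cons_iff y b t).2 ⟨hy, hu⟩⟩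
    · obtain ⟨y, hy, hyz⟩ := exists_letter hr (b.1, !b.2) (z.1, !z.2)
      refine ⟨y, ?_⟩
      have h1 := (isReduced_cons_cons_iff y b t).2 ⟨hy, hu⟩
      unfold FreeGroup.IsReduced at *
      rw [List.isChain_append]
      refine ⟨hv, h1, ?_⟩
      intro x hx w hw
      simp at hx hw
      subst hx hw
      exact (rel_iff _ _).2 hyz

/-- Nonempty reduced lists avoiding `v`, length at most `n`. -/
def avoid (v : List (Lt r)) (n : ℕ) : Set (List (Lt r)) :=
  {l | IsReduced l ∧ l ≠ [] ∧ ¬ v <:+: l ∧ l.length ≤ n}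

lemma avoid_finite (v : List (Lt r)) (n : ℕ) : (avoid v n).Finite :=
  (List.finite_length_le (Lt r) n).subset fun _ h => h.2.2.2

lemma card_ext_avoid (hr : 2 ≤ r) {v u : List (Lt r)} (hv : IsReduced v) (hu : IsReduced u)
    (h0 : u ≠ []) :
    ((extn (v.length + 1) u).filter (fun w => ¬ v <:+: w)).card
      ≤ (2 * r - 1) ^ (v.length + 1) - 1 := by
  rw [← card_extn hu h0]
  apply Nat.le_sub_one_of_lt
  apply Finset.card_lt_card
  rw [Finset.filter_ssubset]
  obtain ⟨y, hy⟩ := exists_glue hr hv hu h0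
  refine ⟨v ++ y :: u, (mem_extn hu _ _).2 ⟨hy, v ++ [y], by simp, by simp⟩, ?_⟩
  simp only [not_not]
  exact (List.prefix_append _ _).isInfix

lemma avoid_step (hr : 2 ≤ r) {v : List (Lt r)} (hv : IsReduced v) (n : ℕ) :
    (avoid v (n + (v.length + 1))).ncard ≤
      ((2 * r - 1) ^ (v.length + 1) - 1) * (avoid v n).ncard + (avoid v (v.length + 1)).ncard := by
  set K := v.length + 1 with hK
  set F := (avoid_finite v n).toFinset with hF
  have hsub : avoid v (n + K) ⊆
      (↑(F.biUnion (fun u => (extn K u).filter (fun w => ¬ v <:+: w))) : Set _) ∪ avoid v K := by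
    intro w hw
    by_cases hl : w.length ≤ K
    · exact Or.inr ⟨hw.1, hw.2.1, hw.2.2.1, hl⟩
    · left
      have hsuf : w.drop K <:+: w := (List.drop_suffix K w).isInfix
      have hred : IsReduced (w.drop K) := hw.1.infix hsuf
      simp only [Finset.mem_coe, Finset.mem_biUnion, Finset.mem_filter]
      refine ⟨w.drop K, ?_, (mem_extn hred _ _).2 ⟨hw.1, w.take K, ?_, ?_⟩, hw.2.2.1⟩
      · rw [hF, Set.Finite.mem_toFinset]
        refine ⟨hred, ?_, fun h => hw.2.2.1 (h.trans hsuf), ?_⟩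
        · intro h
          rw [List.drop_eq_nil_iff] at h
          exact hl h
        · have := hw.2.2.2
          rw [List.length_drop]; omega
      · rw [List.length_take]; omega
      · simp
  refine (Set.ncard_le_ncard hsub ((Finset.finite_toSet _).union (avoid_finite _ _))).trans ?_
  refine (Set.ncard_union_le _ _).trans ?_
  gcongr
  rw [Set.ncard_coe_finset]
  refine (Finset.card_biUnion_le_card_mul _ _ ((2 * r - 1) ^ K - 1) ?_).trans ?_
  · intro u hu
    rw [hF, Set.Finite.mem_toFinset] at hu
    exact card_ext_avoid hr hv hu.1 hu.2.1
  · rw [mul_comm, Set.ncard_eq_toFinset_card _ (avoid_finite v n)]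

lemma avoid_bound (hr : 2 ≤ r) {v : List (Lt r)} (hv : IsReduced v) :
    ∃ M : ℕ, 0 < M ∧ ∀ n, (avoid v n).ncard ≤
      M * ((2 * r - 1) ^ (v.length + 1) - 1) ^ (n / (v.length + 1)) := by
  set K := v.length + 1 with hK
  set W := (avoid v K).ncard with hW
  set D := (2 * r - 1) ^ K - 1 with hD
  have hD2 : 2 ≤ D := by
    have h1 : 2 * r - 1 ≤ (2 * r - 1) ^ K := Nat.le_self_pow (by omega) _
    omega
  have key : ∀ j i, i < K → (avoid v (i + K * j)).ncard + W ≤ (2 * W) * D ^ j := by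
    intro j
    induction j with
    | zero =>
      intro i hi
      have : (avoid v i).ncard ≤ W := Set.ncard_le_ncard
        (fun l h => ⟨h.1, h.2.1, h.2.2.1, h.2.2.2.trans hi.le⟩) (avoid_finite _ _)
      simp; omega
    | succ j ih =>
      intro i hi
      have h1 := avoid_step hr hv (i + K * j)
      have h2 := ih i hi
      rw [← hK, ← hD, ← hW] at h1
      have h3 : i + K * (j + 1) = i + K * j + K := by ring
      rw [h3, pow_succ]
      nlinarith
  refine ⟨2 * W + 1, by omega, fun n => ?_⟩
  have h := key (n / K) (n % K) (Nat.mod_lt _ (by omega))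
  rw [Nat.mod_add_div] at h
  nlinarith [Nat.zero_le (D ^ (n / K))]

lemma ball_finite (S : Set (FreeGroup (Fin r))) (n : ℕ) : {w | w ∈ S ∧ len w ≤ n}.Finite := by
  have h : (FreeGroup.toWord '' {w | w ∈ S ∧ len w ≤ n}).Finite :=
    (List.finite_length_le (Lt r) n).subset (by rintro _ ⟨w, hw, rfl⟩; exact hw.2)
  exact h.of_finite_image FreeGroup.toWord_injective.injOn

lemma cyc_lower (hr : 2 ≤ r) (m : ℕ) :
    (2 * r - 1) ^ m ≤ ballCount {w : FreeGroup (Fin r) | CyclicallyReduced w} (m + 2) := by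
  let x : Lt r := (⟨0, by omega⟩, true)
  rw [← card_extn (u := [x]) IsReduced.singleton (by simp) m, ← Set.ncard_coe_finset]
  have hfin := ball_finite {w : FreeGroup (Fin r) | CyclicallyReduced w} (m + 2)
  refine le_trans (Set.ncard_le_ncard ?_ (hfin.image (fun w => w.toWord.tail)))
    (Set.ncard_image_le hfin)
  intro w hw
  obtain ⟨hred, p, hp, rfl⟩ := (mem_extn IsReduced.singleton _ _).1 (Finset.mem_coe.1 hw)
  obtain ⟨b, t, hbt⟩ : ∃ b t, p ++ [x] = b :: t := List.exists_cons_of_ne_nil (by simp)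
  obtain ⟨y, hy, hyz⟩ := exists_letter hr (b.1, !b.2) (x.1, !x.2)
  have hyr : IsReduced (y :: (p ++ [x])) := by
    rw [hbt] at hred ⊢
    exact (isReduced_cons_cons_iff _ _ _).2 ⟨hy, hred⟩
  have htw : (FreeGroup.mk (y :: (p ++ [x]))).toWord = y :: (p ++ [x]) := by
    rw [FreeGroup.toWord_mk, hyr.reduce_eq]
  refine ⟨FreeGroup.mk (y :: (p ++ [x])), ⟨?_, ?_⟩, ?_⟩
  · show CyclicallyReduced _
    unfold CyclicallyReduced
    rw [htw]
    intro a ha c hc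
    rw [← List.cons_append, List.getLast?_append] at hc
    simp at ha hc
    subst ha hc
    exact hyz
  · unfold len; rw [htw]; simp [hp]
  · simp only [htw, List.tail_cons]

lemma main_bound (hr : 2 ≤ r) (v : FreeGroup (Fin r)) :
    ∃ a : ℝ, 0 < a ∧ ∃ b : ℝ, ∀ n : ℕ, 2 ≤ n →
      (ballCount {w : FreeGroup (Fin r) | ¬ Subword v w} n : ℝ) ≤
        Real.exp (b - a * n) * ballCount {w : FreeGroup (Fin r) | CyclicallyReduced w} n := by
  obtain ⟨M, hM, hMn⟩ := avoid_bound hr (FreeGroup.isReduced_toWord (x := v))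
  set K := v.toWord.length + 1 with hK
  set q := 2 * r - 1 with hq
  set D := q ^ K - 1 with hD
  have hD2 : 2 ≤ D := by
    have h1 : q ≤ q ^ K := Nat.le_self_pow (by omega) _
    omega
  have hqK : q ^ K = D + 1 := by omega
  have hqKr : (q : ℝ) ^ K = D + 1 := by exact_mod_cast hqK
  have hD0 : (0 : ℝ) < D := by exact_mod_cast (by omega : 0 < D)
  have hq1 : (1 : ℝ) ≤ q := by exact_mod_cast (by omega : 1 ≤ q)
  have hK0 : (0 : ℝ) < K := by exact_mod_cast (by omega : 0 < K)
  -- the decay rate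
  set θ : ℝ := (D : ℝ) / (D + 1) with hθ
  have hθ0 : 0 < θ := by positivity
  have hθ1 : θ < 1 := by rw [hθ, div_lt_one (by positivity)]; linarith
  have hlog : Real.log θ < 0 := Real.log_neg hθ0 hθ1
  have hM1 : (0 : ℝ) < ((M : ℝ) + 1) * q ^ 2 := by positivity
  refine ⟨-Real.log θ / K, div_pos (by linarith) hK0,
    Real.log (((M : ℝ) + 1) * q ^ 2) - Real.log θ, fun n hn => ?_⟩
  have hcount : ballCount {w : FreeGroup (Fin r) | ¬ Subword v w} n
      ≤ (avoid v.toWord n).ncard + 1 := by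
    unfold ballCount
    rw [← Set.ncard_image_of_injective _ FreeGroup.toWord_injective]
    refine (Set.ncard_le_ncard (t := insert [] (avoid v.toWord n)) ?_
      ((avoid_finite _ _).insert _)).trans (Set.ncard_insert_le _ _)
    rintro _ ⟨w, hw, rfl⟩
    by_cases h0 : w.toWord = []
    · exact Or.inl h0
    · exact Or.inr ⟨FreeGroup.isReduced_toWord, h0, hw.1, hw.2⟩
  have h1 : (ballCount {w : FreeGroup (Fin r) | ¬ Subword v w} n : ℝ) ≤
      ((M : ℝ) + 1) * D ^ (n / K) := by
    have h2 : ballCount {w : FreeGroup (Fin r) | ¬ Subword v w} n ≤ (M + 1) * D ^ (n / K) := by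
      have := hMn n
      have h3 : 1 ≤ D ^ (n / K) := Nat.one_le_pow _ _ (by omega)
      nlinarith
    exact_mod_cast h2
  have h2 : (q : ℝ) ^ (n - 2) ≤ ballCount {w : FreeGroup (Fin r) | CyclicallyReduced w} n := by
    have := cyc_lower hr (n - 2)
    rw [Nat.sub_add_cancel hn] at this
    exact_mod_cast this
  refine h1.trans (le_trans ?_ (mul_le_mul_of_nonneg_left h2 (Real.exp_pos _).le))
  have hDθ : (D : ℝ) = θ * q ^ K := by rw [hqKr, hθ]; field_simp
  have h3 : (D : ℝ) ^ (n / K) ≤ θ ^ (n / K) * (q ^ 2 * q ^ (n - 2)) := by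
    rw [← pow_add, hDθ, mul_pow, ← pow_mul]
    gcongr
    have := Nat.mul_div_le n K
    omega
  have h4 : θ ^ (n / K) ≤ Real.exp (- Real.log θ - -Real.log θ / K * n) := by
    rw [← Real.exp_log (pow_pos hθ0 (n / K)), Real.log_pow]
    apply Real.exp_le_exp.2
    have h5 : (n : ℝ) / K - 1 ≤ (n / K : ℕ) := by
      have : (n : ℝ) ≤ K * ((n / K : ℕ) + 1) := by
        exact_mod_cast (Nat.lt_mul_div_succ n (by omega : 0 < K)).le
      rw [sub_le_iff_le_add, div_le_iff₀ hK0]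
      linarith
    have h6 : - Real.log θ - -Real.log θ / K * n = Real.log θ * (n / K - 1) := by ring
    rw [h6]
    nlinarith
  have h5 : Real.exp (Real.log (((M : ℝ) + 1) * q ^ 2) - Real.log θ - -Real.log θ / K * n)
      = ((M : ℝ) + 1) * q ^ 2 * Real.exp (- Real.log θ - -Real.log θ / K * n) := by
    rw [← Real.exp_log hM1, ← Real.exp_add, Real.exp_log hM1]
    congr 1
    ring
  rw [h5]
  calc ((M : ℝ) + 1) * D ^ (n / K) ≤ (M + 1) * (θ ^ (n / K) * (q ^ 2 * q ^ (n - 2))) := by gcongr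
    _ ≤ (M + 1) * (Real.exp (- Real.log θ - -Real.log θ / K * n) * (q ^ 2 * q ^ (n - 2))) := by
        gcongr
    _ = _ := by ring

end Helpers

/-- if `v` is poison to `P ⊆ C` on a set `A ⊆ C` that is exponentially
generic in `C` (no element of `A` whose cyclic reduction contains `v` as a subword lies
in `P`), then `P` is exponentially rare in `C`. -/
theorem poison_implies_expRare_cyclicallyReduced {r : ℕ} (hr : 2 ≤ r)
    (P : Set (FreeGroup (Fin r))) (hP : P ⊆ {w : FreeGroup (Fin r) | CyclicallyReduced w})
    (v : FreeGroup (Fin r)) (A : Set (FreeGroup (Fin r)))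
    (hAC : A ⊆ {w : FreeGroup (Fin r) | CyclicallyReduced w})
    (hA : ExpGeneric A {w : FreeGroup (Fin r) | CyclicallyReduced w})
    (hpoison : ∀ w ∈ A,
      (∃ c : FreeGroup (Fin r), IsCyclicReduction c w ∧ Subword v c) → w ∉ P) :
    ExpRare P {w : FreeGroup (Fin r) | CyclicallyReduced w} := by
  obtain ⟨a, ha, b, N, hN⟩ := hA
  obtain ⟨a', ha', b', hb'⟩ := main_bound hr v
  refine ⟨min a a', lt_min ha ha', max b b' + Real.log 2, max N 2, fun n hn => ?_⟩
  have h1 := hN n ((le_max_left _ _).trans hn)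
  have hn2 : 2 ≤ n := (le_max_right _ _).trans hn
  have h2 := hb' n hn2
  have hpos : (0 : ℝ) < ballCount {w : FreeGroup (Fin r) | CyclicallyReduced w} n := by
    have := cyc_lower hr (n - 2)
    rw [Nat.sub_add_cancel hn2] at this
    have h3 : 0 < (2 * r - 1) ^ (n - 2) := pow_pos (by omega) _
    exact_mod_cast h3.trans_le this
  have hcount : ballCount A n ≤
      ballCount ({w : FreeGroup (Fin r) | CyclicallyReduced w} \ P) n +
        ballCount {w : FreeGroup (Fin r) | ¬ Subword v w} n := by
    refine (Set.ncard_le_ncard ?_ ((ball_finite _ n).union (ball_finite _ n))).trans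
      (Set.ncard_union_le _ _)
    rintro w ⟨hw, hl⟩
    by_cases hs : Subword v w
    · exact Or.inl ⟨⟨hAC hw, hpoison w hw ⟨w, ⟨hAC hw, 1, by simp⟩, hs⟩⟩, hl⟩
    · exact Or.inr ⟨hs, hl⟩
  have hcount' : (ballCount A n : ℝ) ≤
      ballCount ({w : FreeGroup (Fin r) | CyclicallyReduced w} \ P) n +
        ballCount {w : FreeGroup (Fin r) | ¬ Subword v w} n := by exact_mod_cast hcount
  rw [le_div_iff₀ hpos] at h1 ⊢
  have hn0 : (0 : ℝ) ≤ n := Nat.cast_nonneg n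
  have e1 : Real.exp (b - a * n) ≤ Real.exp (max b b' - min a a' * n) := by
    apply Real.exp_le_exp.2
    have := mul_le_mul_of_nonneg_right (min_le_left a a') hn0
    linarith [le_max_left b b']
  have e2 : Real.exp (b' - a' * n) ≤ Real.exp (max b b' - min a a' * n) := by
    apply Real.exp_le_exp.2
    have := mul_le_mul_of_nonneg_right (min_le_right a a') hn0
    linarith [le_max_right b b']
  have e3 : Real.exp (max b b' + Real.log 2 - min a a' * n)
      = 2 * Real.exp (max b b' - min a a' * n) := by
    rw [show max b b' + Real.log 2 - min a a' * n
      = Real.log 2 + (max b b' - min a a' * n) by ring, Real.exp_add, Real.exp_log two_pos]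
  rw [e3]
  nlinarith [mul_le_mul_of_nonneg_right e1 hpos.le, mul_le_mul_of_nonneg_right e2 hpos.le]


end VG
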